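/- Let σ be an absolutely continuous probability measure on S¹ and let (μ_t)_{t>0} and μ₀ be absolutely continuous probability measures on S¹ with W₂(μ_t, μ₀) → 0 as t → 0. Assume that the supports of σ and of each μ_t are geodesically convex subsets of S¹ and that their densities with respect to the arc-length measure are bounded above and bounded below away from zero on their supports. Then the lifts of the optimal transport maps satisfy ‖T̃_σ^{μ_t} − T̃_σ^{μ₀}‖_{L²(σ̃)} → 0 as t → 0. -/

import Mathlib

open MeasureTheory Real Set Filter Topology

noncomputable section

instance : Fact (0 < 2 * Real.pi) := ⟨by positivity⟩

/-- The circle `ℝ / 2πℤ`. -/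
abbrev S1 : Type := AddCircle (2 * Real.pi)

/-- The quotient projection `exp_c : ℝ → S¹`. -/
def expc (x : ℝ) : S1 := (x : S1)

/-- The canonical right inverse `log_c : S¹ → [0, 2π)`. -/
def logc (z : S1) : ℝ := (AddCircle.equivIco (2 * Real.pi) 0 z : ℝ)

/-- Squared 2-Wasserstein distance: infimum of `∫ d(x,y)² dγ` over couplings `γ`. -/
def W2sq {X : Type*} [MeasurableSpace X] [PseudoMetricSpace X]
    (μ ν : Measure X) : ℝ :=
  sInf { c : ℝ | ∃ γ : Measure (X × X), IsProbabilityMeasure γ ∧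
      γ.map Prod.fst = μ ∧ γ.map Prod.snd = ν ∧
      c = ∫ p, dist p.1 p.2 ^ 2 ∂γ }

/-- `T` is an optimal transport map from `μ` to `ν`. -/
def IsOTM (μ ν : Measure S1) (T : S1 → S1) : Prop :=
  Measurable T ∧ μ.map T = ν ∧ (∫ z, dist z (T z) ^ 2 ∂μ) = W2sq μ ν

/-- `μ̃`, the pushforward of a measure on `S¹` to `[0, 2π) ⊆ ℝ` via `log_c`. -/
def tilde (μ : Measure S1) : Measure ℝ := μ.map logc

/-- The periodic cumulative distribution function of a (periodicised) measure on `[0,2π)`: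
`F(x) = μ̃([0,x))` for `x ∈ [0,2π]`, extended by `F(x + 2π) = F(x) + 1`. -/
def cdf (μt : Measure ℝ) (x : ℝ) : ℝ :=
  ⌊x / (2 * π)⌋ + (μt (Set.Ico 0 (Int.fract (x / (2 * π)) * (2 * π)))).toReal

/-- The quantile function (generalized inverse) of the periodic cdf. -/
def qf (μt : Measure ℝ) (u : ℝ) : ℝ := sInf { x : ℝ | u ≤ cdf μt x }

/-- The cost `C_{[μ,ν]}(θ) = ∫₀¹ (F_μ̃⁻(u) − F_ν̃⁻(u−θ))² du`. -/
def cost (μ ν : Measure S1) (θ : ℝ) : ℝ :=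
  ∫ u in (0:ℝ)..1, (qf (tilde μ) u - qf (tilde ν) (u - θ)) ^ 2


/-- `T̃ : ℝ → ℝ` is a lift of an optimal transport map from `μ` to `ν`: it is monotone
nondecreasing, `2π`-periodic-equivariant, has zero average displacement over one period,
and `exp_c ∘ T̃ ∘ log_c` is an optimal transport map from `μ` to `ν`. -/
def IsOTMLift (μ ν : Measure S1) (T : ℝ → ℝ) : Prop :=
  Monotone T ∧ (∀ x : ℝ, T (x + 2 * π) = T x + 2 * π) ∧
    (∫ u in (0:ℝ)..(2 * π), (T u - u)) = 0 ∧
    IsOTM μ ν (fun z => expc (T (logc z)))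

/-- A geodesically convex subset of `S¹`: it contains every point lying on a minimising
geodesic between two of its points. -/
def GeodConvex (s : Set S1) : Prop :=
  ∀ x ∈ s, ∀ y ∈ s, ∀ z : S1, dist x z + dist z y = dist x y → z ∈ s

/-- The (topological) support of a measure on `S¹`. -/
def msupport (μ : Measure S1) : Set S1 :=
  { z : S1 | ∀ U : Set S1, IsOpen U → z ∈ U → 0 < μ U }

/-- The measure `μ` has a density (w.r.t. arc length) bounded above and below away from
zero on its geodesically convex support. -/
def NiceDensity (μ : Measure S1) : Prop :=
  GeodConvex (msupport μ) ∧
    ∃ f : S1 → ENNReal, Measurable f ∧ μ = volume.withDensity f ∧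
      ∃ a b : ENNReal, 0 < a ∧ b < ⊤ ∧ ∀ z ∈ msupport μ, a ≤ f z ∧ f z ≤ b

/-- `γ` is a coupling of `μ` and `ν`. -/
def IsCoupling (μ ν : Measure S1) (γ : Measure (S1 × S1)) : Prop :=
  IsProbabilityMeasure γ ∧ γ.map Prod.fst = μ ∧ γ.map Prod.snd = ν

lemma Continuous.integrable_of_compactSpace {X : Type*} [TopologicalSpace X] [CompactSpace X]
    [MeasurableSpace X] [OpensMeasurableSpace X] {f : X → ℝ} (hf : Continuous f)
    (μ : Measure X) [IsFiniteMeasure μ] : Integrable f μ := by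
  obtain ⟨M, hM⟩ := isCompact_univ.exists_bound_of_continuousOn hf.continuousOn
  exact Integrable.of_bound hf.measurable.aestronglyMeasurable M (ae_of_all _ fun x => hM x trivial)

lemma continuous_sqDist : Continuous fun p : S1 × S1 => dist p.1 p.2 ^ 2 := by fun_prop

lemma dist_le_pi (x y : S1) : dist x y ≤ π := by
  have h := AddCircle.norm_le_half_period (2 * π) (x := x - y) (by positivity)
  rw [← dist_eq_norm, abs_of_pos (by positivity)] at h
  linarith

lemma W2sq_le {μ ν : Measure S1} {γ : Measure (S1 × S1)} (h : IsCoupling μ ν γ) :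
    W2sq μ ν ≤ ∫ p, dist p.1 p.2 ^ 2 ∂γ := by
  refine csInf_le ⟨0, ?_⟩ ⟨γ, h.1, h.2.1, h.2.2, rfl⟩
  rintro c ⟨γ, -, -, -, rfl⟩
  exact integral_nonneg fun p => by positivity

lemma le_W2sq {μ ν : Measure S1} [IsProbabilityMeasure μ] [IsProbabilityMeasure ν] {c : ℝ}
    (h : ∀ γ, IsCoupling μ ν γ → c ≤ ∫ p, dist p.1 p.2 ^ 2 ∂γ) : c ≤ W2sq μ ν := by
  refine le_csInf ⟨_, μ.prod ν, inferInstance, by simp, by simp, rfl⟩ ?_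
  rintro _ ⟨γ, h1, h2, h3, rfl⟩
  exact h γ ⟨h1, h2, h3⟩

lemma W2sq_nonneg (μ ν : Measure S1) : 0 ≤ W2sq μ ν := by
  refine Real.sInf_nonneg ?_
  rintro c ⟨γ, -, -, -, rfl⟩
  exact integral_nonneg fun p => by positivity

lemma IsCoupling.of_map {μ ν : Measure S1} [IsProbabilityMeasure μ] {S : S1 → S1}
    (hS : Measurable S) (h : μ.map S = ν) : IsCoupling μ ν (μ.map fun z => (z, S z)) := by
  have hm : Measurable fun z => (z, S z) := measurable_id.prodMk hS
  refine ⟨Measure.isProbabilityMeasure_map hm.aemeasurable, ?_, ?_⟩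
  · rw [Measure.map_map measurable_fst hm]; exact Measure.map_id
  · rw [Measure.map_map measurable_snd hm]; exact h

lemma integral_sqDist_map_graph (μ : Measure S1) {S : S1 → S1} (hS : Measurable S) :
    ∫ p, dist p.1 p.2 ^ 2 ∂(μ.map fun z => (z, S z)) = ∫ z, dist z (S z) ^ 2 ∂μ :=
  integral_map (measurable_id.prodMk hS).aemeasurable
    continuous_sqDist.measurable.aestronglyMeasurable

lemma abs_sub_le_add_mul_sqDist {f : S1 → ℝ} (hf : Continuous f) {ε : ℝ} (hε : 0 < ε) :
    ∃ C, 0 < C ∧ ∀ x y, |f x - f y| ≤ ε + C * dist x y ^ 2 := by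
  obtain ⟨δ, hδ, h⟩ := Metric.uniformContinuous_iff.1
    (CompactSpace.uniformContinuous_of_continuous hf) ε hε
  obtain ⟨M, hM⟩ := isCompact_univ.exists_bound_of_continuousOn hf.continuousOn
  have hM0 : 0 ≤ M := (norm_nonneg _).trans (hM 0 trivial)
  refine ⟨2 * M / δ ^ 2 + 1, by positivity, fun x y => ?_⟩
  rcases lt_or_ge (dist x y) δ with hd | hd
  · have := h hd
    rw [Real.dist_eq] at this
    have : 0 ≤ (2 * M / δ ^ 2 + 1) * dist x y ^ 2 := by positivity
    linarith
  · have h1 : |f x - f y| ≤ 2 * M := by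
      have := norm_sub_le (f x) (f y)
      have := hM x trivial
      have := hM y trivial
      rw [← Real.norm_eq_abs]; linarith
    have h2 : 2 * M ≤ 2 * M / δ ^ 2 * dist x y ^ 2 := by
      rw [div_mul_eq_mul_div, le_div_iff₀ (by positivity)]
      gcongr
    nlinarith [sq_nonneg (dist x y)]

/-- Integrals of a continuous function are controlled by the Wasserstein distance. -/
lemma abs_integral_sub_le {f : S1 → ℝ} (hf : Continuous f) {ε : ℝ} (hε : 0 < ε) :
    ∃ C, 0 < C ∧ ∀ (μ ν : Measure S1) [IsProbabilityMeasure μ] [IsProbabilityMeasure ν],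
      |∫ x, f x ∂μ - ∫ x, f x ∂ν| ≤ ε + C * W2sq μ ν := by
  obtain ⟨C, hC, h⟩ := abs_sub_le_add_mul_sqDist hf hε
  refine ⟨C, hC, fun μ ν _ _ => ?_⟩
  suffices (|∫ x, f x ∂μ - ∫ x, f x ∂ν| - ε) / C ≤ W2sq μ ν by
    rw [div_le_iff₀ hC] at this; linarith
  refine le_W2sq fun γ ⟨_, hμ, hν⟩ => ?_
  have i1 : Integrable (fun p : S1 × S1 => f p.1) γ :=
    (hf.comp continuous_fst).integrable_of_compactSpace γ
  have i2 : Integrable (fun p : S1 × S1 => f p.2) γ :=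
    (hf.comp continuous_snd).integrable_of_compactSpace γ
  have i3 := continuous_sqDist.integrable_of_compactSpace γ
  rw [← hμ, ← hν, integral_map measurable_fst.aemeasurable hf.measurable.aestronglyMeasurable,
    integral_map measurable_snd.aemeasurable hf.measurable.aestronglyMeasurable,
    ← integral_sub i1 i2, div_le_iff₀ hC]
  have h1 := (abs_integral_le_integral_abs (f := fun p : S1 × S1 => f p.1 - f p.2) (μ := γ)).trans
    (integral_mono (i1.sub i2).abs ((integrable_const ε).add (i3.const_mul C)) fun p => h p.1 p.2)
  simp only [Pi.add_apply] at h1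
  rw [integral_add (integrable_const ε) (i3.const_mul C), integral_const_mul] at h1
  simp only [integral_const, probReal_univ, one_smul] at h1
  linarith

open ProbabilityTheory in
/-- Stability of the optimal cost in the target measure. -/
lemma W2sq_le_add {ε : ℝ} (hε : 0 < ε) :
    ∃ C, 0 < C ∧ ∀ (σ μ ν : Measure S1) [IsProbabilityMeasure σ] [IsProbabilityMeasure μ]
      [IsProbabilityMeasure ν] (S : S1 → S1), Measurable S → σ.map S = μ →
      W2sq σ ν ≤ (∫ z, dist z (S z) ^ 2 ∂σ) + ε + C * W2sq ν μ := by
  refine ⟨π ^ 2 / ε, by positivity, fun σ μ ν _ _ _ S hS hSμ => ?_⟩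
  have hC : 0 < π ^ 2 / ε := by positivity
  suffices (W2sq σ ν - (∫ z, dist z (S z) ^ 2 ∂σ) - ε) / (π ^ 2 / ε) ≤ W2sq ν μ by
    rw [div_le_iff₀ hC] at this; linarith
  refine le_W2sq fun γ ⟨_, hν, hμ⟩ => ?_
  set η : Measure (S1 × S1) := γ.map Prod.swap with hη
  have : IsProbabilityMeasure η := Measure.isProbabilityMeasure_map measurable_swap.aemeasurable
  have hη1 : η.fst = μ := by
    rw [Measure.fst, hη, Measure.map_map measurable_fst measurable_swap]; exact hμ
  have hη2 : η.snd = ν := by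
    rw [Measure.snd, hη, Measure.map_map measurable_snd measurable_swap]; exact hν
  set κ : Kernel S1 S1 := η.condKernel
  have hκ : μ ⊗ₘ κ = η := by rw [← hη1]; exact η.disintegrate η.condKernel
  set P : Measure (S1 × S1) := σ ⊗ₘ κ.comap S hS with hP
  have hmS : Measurable (Prod.map S id : S1 × S1 → S1 × S1) := hS.prodMap measurable_id
  have hPη : P.map (Prod.map S id) = η := by
    ext s hs
    rw [Measure.map_apply hmS hs, hP, Measure.compProd_apply (hmS hs), ← hκ,
      Measure.compProd_apply hs, ← hSμ, lintegral_map (Kernel.measurable_kernel_prodMk_left hs) hS]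
    rfl
  have hP1 : P.map Prod.fst = σ := Measure.fst_compProd σ _
  have hP2 : P.map Prod.snd = ν := by
    rw [← hη2, ← hPη, Measure.snd, Measure.map_map measurable_snd hmS]
    rfl
  have hle := W2sq_le ⟨inferInstance, hP1, hP2⟩
  have hb (z y : S1) : dist z y ^ 2 ≤
      dist z (S z) ^ 2 + ε + π ^ 2 / ε * dist (S z) y ^ 2 := by
    have t1 := dist_triangle z (S z) y
    have t2 := dist_le_pi z y
    have t3 := dist_le_pi z (S z)
    have t4 : 2 * π * dist (S z) y ≤ ε + π ^ 2 / ε * dist (S z) y ^ 2 := by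
      have : ε + π ^ 2 / ε * dist (S z) y ^ 2 - 2 * π * dist (S z) y
        = (ε - π * dist (S z) y) ^ 2 / ε := by field_simp; ring
      have : 0 ≤ (ε - π * dist (S z) y) ^ 2 / ε := by positivity
      linarith
    have d1 := dist_nonneg (x := z) (y := y)
    have d2 := dist_nonneg (x := z) (y := S z)
    have d3 := dist_nonneg (x := S z) (y := y)
    nlinarith
  have hint1 : ∫ p, dist p.1 (S p.1) ^ 2 ∂P = ∫ z, dist z (S z) ^ 2 ∂σ := by
    rw [← hP1, integral_map measurable_fst.aemeasurable]
    exact ((measurable_id.dist hS).pow_const 2).aestronglyMeasurable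
  have hint2 : ∫ p, dist (S p.1) p.2 ^ 2 ∂P = ∫ p, dist p.1 p.2 ^ 2 ∂γ := by
    calc ∫ p, dist (S p.1) p.2 ^ 2 ∂P = ∫ p, dist p.1 p.2 ^ 2 ∂η := by
          rw [← hPη, integral_map hmS.aemeasurable
            continuous_sqDist.measurable.aestronglyMeasurable]
          rfl
      _ = _ := by
          rw [hη, integral_map measurable_swap.aemeasurable
            continuous_sqDist.measurable.aestronglyMeasurable]
          simp [dist_comm]
  have i0 := continuous_sqDist.integrable_of_compactSpace P
  have ib {g : S1 × S1 → ℝ} (hg : Measurable g) (hg2 : ∀ p, 0 ≤ g p ∧ g p ≤ π) :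
      Integrable (fun p => g p ^ 2) P :=
    Integrable.of_bound (hg.pow_const 2).aestronglyMeasurable (π ^ 2) (ae_of_all _ fun p => by
      rw [Real.norm_eq_abs, abs_of_nonneg (by positivity)]
      have := hg2 p
      gcongr <;> tauto)
  have i1 : Integrable (fun p : S1 × S1 => dist p.1 (S p.1) ^ 2) P :=
    ib (measurable_fst.dist (hS.comp measurable_fst)) fun p => ⟨dist_nonneg, dist_le_pi _ _⟩
  have i2 : Integrable (fun p : S1 × S1 => dist (S p.1) p.2 ^ 2) P :=
    ib ((hS.comp measurable_fst).dist measurable_snd) fun p => ⟨dist_nonneg, dist_le_pi _ _⟩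
  have hmono := integral_mono i0 ((i1.add (integrable_const ε)).add (i2.const_mul (π ^ 2 / ε)))
    fun p => hb p.1 p.2
  rw [integral_add' (i1.add (integrable_const ε)) (i2.const_mul _),
    integral_add' i1 (integrable_const ε), integral_const_mul, hint1, hint2] at hmono
  simp only [integral_const, probReal_univ, one_smul] at hmono
  rw [div_le_iff₀ hC]
  linarith
/-- Points of the support of an optimal coupling are pairwise cyclically monotone. -/
lemma IsCoupling.sqDist_add_le_of_mem_support {μ ν : Measure S1} {γ : Measure (S1 × S1)}
    (h : IsCoupling μ ν γ) (hopt : ∫ p, dist p.1 p.2 ^ 2 ∂γ = W2sq μ ν) {p q : S1 × S1}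
    (hp : p ∈ γ.support) (hq : q ∈ γ.support) :
    dist p.1 p.2 ^ 2 + dist q.1 q.2 ^ 2 ≤ dist p.1 q.2 ^ 2 + dist q.1 p.2 ^ 2 := by
  by_contra! hlt
  obtain ⟨_, hμ, hν⟩ := h
  let F : (S1 × S1) × (S1 × S1) → ℝ := fun w =>
    (dist w.1.1 w.1.2 ^ 2 + dist w.2.1 w.2.2 ^ 2) - (dist w.1.1 w.2.2 ^ 2 + dist w.2.1 w.1.2 ^ 2)
  have hF : Continuous F := by fun_prop
  obtain ⟨U, V, hU, hV, hpU, hqV, hUV⟩ := isOpen_prod_iff.1 (isOpen_Ioi.preimage hF) p q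
    (show 0 < F (p, q) by simp only [F]; linarith)
  have hγU : 0 < γ U := (Measure.mem_support_iff_forall p).1 hp U (hU.mem_nhds hpU)
  have hγV : 0 < γ V := (Measure.mem_support_iff_forall q).1 hq V (hV.mem_nhds hqV)
  set A := (γ.restrict U).prod (γ.restrict V) with hA
  have m1 : Measurable fun w : (S1 × S1) × (S1 × S1) => (w.1.1, w.2.2) := by fun_prop
  have m2 : Measurable fun w : (S1 × S1) × (S1 × S1) => (w.2.1, w.1.2) := by fun_prop
  set ρ₁ : Measure (S1 × S1) := (2⁻¹ : ENNReal) • (A.map Prod.fst + A.map Prod.snd) with hρ₁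
  set ρ₂ : Measure (S1 × S1) := (2⁻¹ : ENNReal) •
    (A.map (fun w => (w.1.1, w.2.2)) + A.map (fun w => (w.2.1, w.1.2))) with hρ₂
  have hle : ρ₁ ≤ γ := by
    have hs (W W' : Set (S1 × S1)) : (γ.restrict W univ) • γ.restrict W' ≤ γ := by
      intro s
      calc (γ.restrict W univ • γ.restrict W') s = γ.restrict W univ * γ.restrict W' s := rfl
        _ ≤ 1 * γ s := by
            gcongr
            · exact (Measure.restrict_apply_le _ _).trans prob_le_one
            · exact Measure.restrict_le_self
        _ = γ s := one_mul _
    rw [hρ₁, hA, Measure.map_fst_prod, Measure.map_snd_prod]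
    intro s
    have e1 := hs V U s
    have e2 := hs U V s
    calc _ = (2⁻¹ : ENNReal) * ((γ.restrict V univ • γ.restrict U) s
            + (γ.restrict U univ • γ.restrict V) s) := rfl
      _ ≤ 2⁻¹ * (γ s + γ s) := by gcongr
      _ = γ s := by rw [← two_mul, ← mul_assoc, ENNReal.inv_mul_cancel (by simp) (by simp), one_mul]
  have : IsFiniteMeasure ρ₁ := isFiniteMeasure_of_le γ hle
  have : IsFiniteMeasure ρ₂ := by
    rw [hρ₂]
    exact Measure.smul_finite _ (by simp)
  have hsum : γ - ρ₁ + ρ₁ = γ := Measure.sub_add_cancel_of_le hle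
  have hfst : ρ₂.map Prod.fst = ρ₁.map Prod.fst := by
    rw [hρ₁, hρ₂, Measure.map_smul, Measure.map_smul, Measure.map_add _ _ measurable_fst,
      Measure.map_add _ _ measurable_fst, Measure.map_map measurable_fst m1,
      Measure.map_map measurable_fst m2, Measure.map_map measurable_fst measurable_fst,
      Measure.map_map measurable_fst measurable_snd]
    rfl
  have hsnd : ρ₂.map Prod.snd = ρ₁.map Prod.snd := by
    rw [hρ₁, hρ₂, Measure.map_smul, Measure.map_smul, Measure.map_add _ _ measurable_snd,
      Measure.map_add _ _ measurable_snd, Measure.map_map measurable_snd m1,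
      Measure.map_map measurable_snd m2, Measure.map_map measurable_snd measurable_fst,
      Measure.map_map measurable_snd measurable_snd, add_comm]
    rfl
  have hmap {f : S1 × S1 → S1} (hf : Measurable f) (he : ρ₂.map f = ρ₁.map f) :
      (γ - ρ₁ + ρ₂).map f = γ.map f := by
    rw [Measure.map_add _ _ hf, he, ← Measure.map_add _ _ hf, hsum]
  have hγ' : IsCoupling μ ν (γ - ρ₁ + ρ₂) := by
    refine ⟨?_, (hmap measurable_fst hfst).trans hμ, (hmap measurable_snd hsnd).trans hν⟩
    rw [← Measure.isProbabilityMeasure_map_iff measurable_fst.aemeasurable,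
      hmap measurable_fst hfst]
    exact Measure.isProbabilityMeasure_map measurable_fst.aemeasurable
  have hcost := W2sq_le hγ'
  have hm := continuous_sqDist.measurable
  have ic (m : Measure (S1 × S1)) [IsFiniteMeasure m] := continuous_sqDist.integrable_of_compactSpace m
  rw [← hopt] at hcost
  nth_rewrite 1 [← hsum] at hcost
  rw [integral_add_measure (ic _) (ic _), integral_add_measure (ic _) (ic _), hρ₁, hρ₂,
    integral_smul_measure, integral_smul_measure, integral_add_measure (ic _) (ic _),
    integral_add_measure (ic _) (ic _),
    integral_map measurable_fst.aemeasurable hm.aestronglyMeasurable,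
    integral_map measurable_snd.aemeasurable hm.aestronglyMeasurable,
    integral_map m1.aemeasurable hm.aestronglyMeasurable,
    integral_map m2.aemeasurable hm.aestronglyMeasurable,
    ← integral_add, ← integral_add] at hcost
  rotate_left
  iterate 4 exact Continuous.integrable_of_compactSpace (by fun_prop) _
  have hpos : 0 < ∫ w, F w ∂A := by
    have hAF : ∀ᵐ w ∂A, 0 < F w := by
      have : A = (γ.prod γ).restrict (U ×ˢ V) := Measure.prod_restrict _ _
      rw [this, ae_restrict_iff' (hU.prod hV).measurableSet]
      exact ae_of_all _ fun w hw => hUV hw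
    rw [integral_pos_iff_support_of_nonneg_ae (hAF.mono fun w hw => hw.le)
      (hF.integrable_of_compactSpace _)]
    have h1 : A (Function.support F) = A univ :=
      measure_congr (hAF.mono fun w hw => eq_true hw.ne' |>.trans (eq_true trivial).symm)
    rw [h1, hA, ← univ_prod_univ, Measure.prod_prod]
    simpa using ⟨hγU, hγV⟩
  simp only [F] at hpos
  rw [integral_sub] at hpos
  rotate_left
  iterate 2 exact Continuous.integrable_of_compactSpace (by fun_prop) _
  simp only [ENNReal.toReal_inv, ENNReal.toReal_ofNat, smul_eq_mul] at hcost
  linarith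

lemma exists_lift (x : ℝ) (w : S1) : ∃ y : ℝ, (y : S1) = w ∧ |x - y| = dist (x : S1) w := by
  obtain ⟨y, rfl⟩ := QuotientAddGroup.mk_surjective w
  refine ⟨y + round ((2 * π)⁻¹ * (x - y)) * (2 * π), ?_, ?_⟩
  · rw [AddCircle.coe_add, add_eq_left, AddCircle.coe_eq_zero_iff]
    exact ⟨_, zsmul_eq_mul _ _⟩
  · rw [dist_eq_norm, ← AddCircle.coe_sub, AddCircle.norm_eq]
    congr 1; ring

lemma dist_coe_le (x y : ℝ) : dist (x : S1) (y : S1) ≤ |x - y| := by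
  rw [dist_eq_norm, ← AddCircle.coe_sub]
  exact QuotientAddGroup.norm_mk_le_norm

lemma coe_logc (z : S1) : ((logc z : ℝ) : S1) = z := AddCircle.coe_equivIco

lemma logc_mem (z : S1) : logc z ∈ Ico 0 (2 * π) := by
  have := (AddCircle.equivIco (2 * π) 0 z).2
  exact ⟨this.1, this.2.trans_eq (zero_add _)⟩

lemma logc_injective : Function.Injective logc := fun z w h => by
  rw [← coe_logc z, h, coe_logc]

lemma measurable_logc : Measurable logc :=
  measurable_subtype_coe.comp (AddCircle.measurableEquivIco (2 * π) 0).measurable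

/-- Nearest lifts of pairwise cyclically monotone pairs are monotone. -/
lemma lift_le_lift {x x' y y' : ℝ} {z z' : S1} (hx : (x : S1) = z) (hx' : (x' : S1) = z')
    (hxx' : x < x') (hy : |x - y| = dist z (y : S1)) (hy' : |x' - y'| = dist z' (y' : S1))
    (h : dist z (y : S1) ^ 2 + dist z' (y' : S1) ^ 2 ≤
      dist z (y' : S1) ^ 2 + dist z' (y : S1) ^ 2) : y ≤ y' := by
  subst hx hx'
  have h1 : dist (x : S1) (y' : S1) ^ 2 ≤ (x - y') ^ 2 := by
    rw [← sq_abs (x - y')]; gcongr; exact dist_coe_le _ _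
  have h2 : dist (x' : S1) (y : S1) ^ 2 ≤ (x' - y) ^ 2 := by
    rw [← sq_abs (x' - y)]; gcongr; exact dist_coe_le _ _
  rw [← hy, ← hy', sq_abs, sq_abs] at h
  nlinarith

lemma countable_setOf_ne {K : Set (S1 × S1)}
    (hK : ∀ p ∈ K, ∀ q ∈ K,
      dist p.1 p.2 ^ 2 + dist q.1 q.2 ^ 2 ≤ dist p.1 q.2 ^ 2 + dist q.1 p.2 ^ 2) (S S' : S1 → S1) :
    {z | (z, S z) ∈ K ∧ (z, S' z) ∈ K ∧ S z ≠ S' z}.Countable := by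
  choose f hf hf' using fun z => exists_lift (logc z) (S z)
  choose g hg hg' using fun z => exists_lift (logc z) (S' z)
  replace hf' (z : S1) : |logc z - f z| = dist z (f z : S1) := by rw [hf' z, coe_logc, hf]
  replace hg' (z : S1) : |logc z - g z| = dist z (g z : S1) := by rw [hg' z, coe_logc, hg]
  set D := {z | (z, S z) ∈ K ∧ (z, S' z) ∈ K ∧ S z ≠ S' z}
  have hmono {z w : S1} {a b : ℝ} (hzw : logc z < logc w) (hz : (z, (a : S1)) ∈ K)
      (hw : (w, (b : S1)) ∈ K) (ha : |logc z - a| = dist z (a : S1))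
      (hb : |logc w - b| = dist w (b : S1)) : a ≤ b := by
    have h := hK _ hz _ hw
    exact lift_le_lift (coe_logc z) (coe_logc w) hzw ha hb h
  have hmono' {z w : S1} (hz : z ∈ D) (hw : w ∈ D) (hzw : logc z < logc w) :
      max (f z) (g z) ≤ min (f w) (g w) := by
    obtain ⟨z1, z2, -⟩ := hz
    obtain ⟨w1, w2, -⟩ := hw
    rw [← hf] at z1 w1
    rw [← hg] at z2 w2
    exact max_le (le_min (hmono hzw z1 w1 (hf' z) (hf' w)) (hmono hzw z1 w2 (hf' z) (hg' w)))
      (le_min (hmono hzw z2 w1 (hg' z) (hf' w)) (hmono hzw z2 w2 (hg' z) (hg' w)))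
  have hdisj : D.PairwiseDisjoint fun z => Ioo (min (f z) (g z)) (max (f z) (g z)) := by
    intro z hz w hw hne
    rw [Function.onFun, Set.disjoint_left]
    rintro u ⟨hu1, hu2⟩ ⟨hu3, hu4⟩
    rcases lt_or_gt_of_ne (logc_injective.ne hne) with hlt | hlt
    · exact absurd (hmono' hz hw hlt) (not_le.2 (hu3.trans hu2))
    · exact absurd (hmono' hw hz hlt) (not_le.2 (hu1.trans hu4))
  refine hdisj.countable_of_isOpen (fun _ _ => isOpen_Ioo) fun z hz => ?_
  rw [nonempty_Ioo, min_lt_max]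
  exact fun h => hz.2.2 (by rw [← hf, ← hg, h])

lemma measure_countable_eq_zero {σ : Measure S1} (hσ : σ ≪ volume) {s : Set S1}
    (hs : s.Countable) : σ s = 0 := by
  have : NullSingletonClass (volume : Measure S1) :=
    ⟨fun x => by rw [← Metric.closedBall_zero, AddCircle.volume_closedBall]; simp⟩
  exact hσ (hs.measure_zero _)

/-- Uniqueness of optimal transport maps from an absolutely continuous measure. -/
lemma IsOTM.ae_eq {σ μ : Measure S1} [IsProbabilityMeasure σ] (hσ : σ ≪ volume) {S S' : S1 → S1}
    (h : IsOTM σ μ S) (h' : IsOTM σ μ S') : S =ᵐ[σ] S' := by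
  obtain ⟨hS, hSμ, hc⟩ := h
  obtain ⟨hS', hSμ', hc'⟩ := h'
  have c1 := IsCoupling.of_map hS hSμ
  have c2 := IsCoupling.of_map hS' hSμ'
  have k1 := integral_sqDist_map_graph σ hS
  have k2 := integral_sqDist_map_graph σ hS'
  have m1 : Measurable fun z => (z, S z) := measurable_id.prodMk hS
  have m2 : Measurable fun z => (z, S' z) := measurable_id.prodMk hS'
  set γ₁ := σ.map fun z => (z, S z) with hγ₁
  set γ₂ := σ.map fun z => (z, S' z) with hγ₂
  have := c1.1
  have := c2.1
  set γ : Measure (S1 × S1) := (2⁻¹ : ENNReal) • (γ₁ + γ₂) with hγ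
  have hhalf (m : Measure S1) : (2⁻¹ : ENNReal) • (m + m) = m := by
    rw [← two_smul ENNReal m, smul_smul, ENNReal.inv_mul_cancel (by simp) (by simp), one_smul]
  have hfst : γ.map Prod.fst = σ := by
    rw [hγ, Measure.map_smul, Measure.map_add _ _ measurable_fst, c1.2.1, c2.2.1, hhalf]
  have hsnd : γ.map Prod.snd = μ := by
    rw [hγ, Measure.map_smul, Measure.map_add _ _ measurable_snd, c1.2.2, c2.2.2, hhalf]
  have hcoup : IsCoupling σ μ γ := by
    refine ⟨?_, hfst, hsnd⟩
    rw [← Measure.isProbabilityMeasure_map_iff measurable_fst.aemeasurable, hfst]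
    infer_instance
  have hopt : ∫ p, dist p.1 p.2 ^ 2 ∂γ = W2sq σ μ := by
    rw [hγ, integral_smul_measure, integral_add_measure
      (continuous_sqDist.integrable_of_compactSpace _)
      (continuous_sqDist.integrable_of_compactSpace _), k1, k2, hc, hc']
    simp only [ENNReal.toReal_inv, ENNReal.toReal_ofNat, smul_eq_mul]
    ring
  have := hcoup.1
  have hnull : γ γ.supportᶜ = 0 := Measure.measure_compl_support
  have hnull' : γ₁ γ.supportᶜ = 0 ∧ γ₂ γ.supportᶜ = 0 := by
    have : (2⁻¹ : ENNReal) * (γ₁ γ.supportᶜ + γ₂ γ.supportᶜ) = 0 := hnull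
    simpa using this
  have hms : MeasurableSet γ.supportᶜ := Measure.isClosed_support.measurableSet.compl
  have a1 : ∀ᵐ z ∂σ, (z, S z) ∈ γ.support := by
    have := hnull'.1
    rwa [hγ₁, Measure.map_apply m1 hms] at this
  have a2 : ∀ᵐ z ∂σ, (z, S' z) ∈ γ.support := by
    have := hnull'.2
    rwa [hγ₂, Measure.map_apply m2 hms] at this
  have hcount := measure_countable_eq_zero hσ (countable_setOf_ne
    (fun p hp q hq => hcoup.sqDist_add_le_of_mem_support hopt hp hq) S S')
  filter_upwards [a1, a2, measure_eq_zero_iff_ae_notMem.1 hcount] with z h1 h2 h3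
  by_contra hne
  exact h3 ⟨h1, h2, hne⟩
lemma logc_coe {x : ℝ} (hx : x ∈ Ico 0 (2 * π)) : logc (x : S1) = x :=
  AddCircle.equivIco_coe_of_mem (by simpa using hx)

lemma ae_logc_of_ae_restrict {σ : Measure S1} (hσ : σ ≪ volume) {p : ℝ → Prop}
    (hp : MeasurableSet {x | p x}) (h : ∀ᵐ x ∂volume.restrict (Ioc 0 (2 * π)), p x) :
    ∀ᵐ z ∂σ, p (logc z) := by
  refine hσ.ae_le ?_
  have hm : MeasurableSet {z : S1 | ¬ p (logc z)} := (measurable_logc hp).compl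
  change volume {z : S1 | ¬ p (logc z)} = 0
  rw [AddCircle.add_projection_respects_measure (2 * π) 0 hm]
  rw [ae_restrict_iff' measurableSet_Ioc] at h
  refine measure_mono_null (t := {x | ¬ (x ∈ Ioc 0 (2 * π) → p x)} ∪ {2 * π}) ?_
    (measure_union_null h (by simp))
  rintro x ⟨hx, hx0, hx1⟩
  rw [zero_add] at hx1
  rcases hx1.eq_or_lt with rfl | hlt
  · exact Or.inr rfl
  · left
    have hx' : ¬ p (logc (x : S1)) := hx
    rw [logc_coe ⟨hx0.le, hlt⟩] at hx'
    exact fun H => hx' (H ⟨hx0, hx1⟩)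

/-- Two monotone degree-one maps with the same mean displacement cannot differ almost everywhere
by at least a full turn. -/
lemma not_ae_add_two_pi_le {σ : Measure S1} [IsProbabilityMeasure σ] (hσ : σ ≪ volume)
    {T T' : ℝ → ℝ} (hT : Monotone T) (hT' : Monotone T')
    (hper : ∀ x, T (x + 2 * π) = T x + 2 * π) (hper' : ∀ x, T' (x + 2 * π) = T' x + 2 * π)
    (hmean : ∫ u in (0:ℝ)..(2 * π), (T u - u) = 0) (hmean' : ∫ u in (0:ℝ)..(2 * π), (T' u - u) = 0) :
    ¬ ∀ᵐ z ∂σ, T' (logc z) + 2 * π ≤ T (logc z) := by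
  intro h
  obtain ⟨z₀, hz₀⟩ := h.exists
  set x₀ := logc z₀
  obtain ⟨hx1, hx2⟩ : x₀ ∈ Ico 0 (2 * π) := logc_mem z₀
  have hle : ∀ u ∈ Icc 0 (2 * π), T' u ≤ T u := by
    rintro u ⟨hu1, hu2⟩
    rcases le_total x₀ u with hxu | hux
    · have e1 := hT' (show u ≤ x₀ + 2 * π by linarith)
      have e2 := hT hxu
      rw [hper'] at e1
      linarith
    · have e1 := hT (show x₀ - 2 * π ≤ u by linarith)
      have e2 := hT' hux
      have e3 := hper (x₀ - 2 * π)
      rw [sub_add_cancel] at e3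
      linarith
  have i1 : IntervalIntegrable T volume 0 (2 * π) := hT.intervalIntegrable
  have i2 : IntervalIntegrable T' volume 0 (2 * π) := hT'.intervalIntegrable
  have i3 : IntervalIntegrable (fun u : ℝ => u) volume 0 (2 * π) := intervalIntegral.intervalIntegrable_id
  rw [intervalIntegral.integral_sub i1 i3] at hmean
  rw [intervalIntegral.integral_sub i2 i3] at hmean'
  have hzero : ∫ u in (0:ℝ)..(2 * π), (T u - T' u) = 0 := by
    rw [intervalIntegral.integral_sub i1 i2]; linarith
  have hpi : (0:ℝ) ≤ 2 * π := by positivity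
  rw [intervalIntegral.integral_of_le hpi, setIntegral_eq_zero_iff_of_nonneg_ae
    ((ae_restrict_iff' measurableSet_Ioc).2 (ae_of_all _ fun u hu =>
      sub_nonneg.2 (hle u (Ioc_subset_Icc_self hu)))) (i1.sub i2).1] at hzero
  have hae := ae_logc_of_ae_restrict hσ
    (measurableSet_eq_fun (hT.measurable.sub hT'.measurable) measurable_const) hzero
  obtain ⟨z, hz1, hz2⟩ := (h.and hae).exists
  have hz2' : T (logc z) - T' (logc z) = 0 := hz2
  linarith [Real.pi_pos]

lemma exists_sub_eq_of_expc_eq {a b : ℝ} (h : expc a = expc b) :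
    ∃ k : ℤ, a - b = k * (2 * π) := by
  have h' : ((a - b : ℝ) : S1) = 0 := by
    rw [AddCircle.coe_sub, sub_eq_zero]; exact h
  obtain ⟨k, hk⟩ := (AddCircle.coe_eq_zero_iff _).1 h'
  exact ⟨k, by rw [← hk, zsmul_eq_mul]⟩

lemma expc_add_two_pi (a : ℝ) : expc (a + 2 * π) = expc a :=
  AddCircle.coe_add_period _ _

/-- On two points with different images, two monotone lifts of one circle map differ by the same
number of turns. -/
lemma sub_eq_sub_of_expc_ne {T T' : ℝ → ℝ} (hT : Monotone T) (hT' : Monotone T')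
    (hper : ∀ x, T (x + 2 * π) = T x + 2 * π) (hper' : ∀ x, T' (x + 2 * π) = T' x + 2 * π)
    {x y : ℝ} (hx : x ∈ Ico 0 (2 * π)) (hy : y ∈ Ico 0 (2 * π)) (hxy : x ≤ y)
    (ex : expc (T x) = expc (T' x)) (ey : expc (T y) = expc (T' y))
    (hne : expc (T x) ≠ expc (T y)) : T x - T' x = T y - T' y := by
  obtain ⟨k, hk⟩ := exists_sub_eq_of_expc_eq ex
  obtain ⟨l, hl⟩ := exists_sub_eq_of_expc_eq ey
  have b1 := hT hxy
  have b2 := hT' hxy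
  have hyx : y ≤ x + 2 * π := by linarith [hx.1, hy.2]
  have b3 := hT hyx
  have b4 := hT' hyx
  rw [hper] at b3
  rw [hper'] at b4
  have n1 : T x ≠ T y := fun h => hne (by rw [h])
  have n2 : T y ≠ T x + 2 * π := fun h => hne (by rw [h, expc_add_two_pi])
  have n3 := lt_of_le_of_ne b1 n1
  have n4 := lt_of_le_of_ne b3 n2
  have hpi : 0 < 2 * π := by positivity
  have hkl : k = l := by
    have h1 : ((l - k : ℤ) : ℝ) * (2 * π) < 1 * (2 * π) := by push_cast; linarith
    have h2 : (-1) * (2 * π) < ((l - k : ℤ) : ℝ) * (2 * π) := by push_cast; linarith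
    have h3 := lt_of_mul_lt_mul_right h1 hpi.le
    have h4 := lt_of_mul_lt_mul_right h2 hpi.le
    norm_cast at h3 h4
    omega
  rw [hk, hl, hkl]

/-- Uniqueness of the normalised monotone lift of the optimal transport map. -/
lemma IsOTMLift.ae_eq {σ μ : Measure S1} [IsProbabilityMeasure σ] (hσ : σ ≪ volume)
    (hμ : μ ≪ volume) {T T' : ℝ → ℝ} (h : IsOTMLift σ μ T) (h' : IsOTMLift σ μ T') :
    ∀ᵐ z ∂σ, T (logc z) = T' (logc z) := by
  obtain ⟨hT, hper, hmean, hopt⟩ := h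
  obtain ⟨hT', hper', hmean', hopt'⟩ := h'
  have hD := hopt.ae_eq hσ hopt'
  obtain ⟨z₀, hz₀⟩ := hD.exists
  have hne : ∀ᵐ w ∂σ, expc (T (logc w)) ≠ expc (T (logc z₀)) := by
    have := measure_countable_eq_zero hμ (countable_singleton (expc (T (logc z₀))))
    rw [← hopt.2.1, Measure.map_apply hopt.1 (measurableSet_singleton _)] at this
    exact measure_eq_zero_iff_ae_notMem.1 this
  obtain ⟨k, hk⟩ := exists_sub_eq_of_expc_eq hz₀
  have hc : ∀ᵐ w ∂σ, T (logc w) - T' (logc w) = k * (2 * π) := by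
    filter_upwards [hD, hne] with w hw hwne
    rw [← hk]
    rcases le_total (logc w) (logc z₀) with hle | hle
    · exact sub_eq_sub_of_expc_ne hT hT' hper hper' (logc_mem w) (logc_mem z₀) hle hw hz₀ hwne
    · exact (sub_eq_sub_of_expc_ne hT hT' hper hper' (logc_mem z₀) (logc_mem w) hle hz₀ hw
        hwne.symm).symm
  have hpi : 0 < 2 * π := by positivity
  rcases lt_trichotomy k 0 with hk0 | rfl | hk0
  · refine absurd ?_ (not_ae_add_two_pi_le hσ hT' hT hper' hper hmean' hmean)
    filter_upwards [hc] with w hw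
    have : (k : ℝ) ≤ -1 := by exact_mod_cast Int.le_sub_one_of_lt hk0
    nlinarith
  · filter_upwards [hc] with w hw
    simpa [sub_eq_zero] using hw
  · refine absurd ?_ (not_ae_add_two_pi_le hσ hT hT' hper hper' hmean hmean')
    filter_upwards [hc] with w hw
    have : (1 : ℝ) ≤ k := by exact_mod_cast hk0
    nlinarith
/-- Helly's selection theorem. -/
lemma exists_subseq_tendsto_of_monotone {T : ℕ → ℝ → ℝ} (hT : ∀ n, Monotone (T n))
    (hb : ∀ x, ∃ C, ∀ n, |T n x| ≤ C) (hper : ∀ n x, T n (x + 2 * π) = T n x + 2 * π) :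
    ∃ φ : ℕ → ℕ, StrictMono φ ∧ ∃ G : ℝ → ℝ, Monotone G ∧ (∀ x, G (x + 2 * π) = G x + 2 * π) ∧
      {x | ¬ Tendsto (fun n => T (φ n) x) atTop (𝓝 (G x))}.Countable := by
  choose C hC using hb
  have hK : IsCompact (Set.pi univ fun q : ℚ => Icc (-C q) (C q)) :=
    isCompact_univ_pi fun q => isCompact_Icc
  obtain ⟨g, -, φ, hφ, hg⟩ := hK.isSeqCompact (x := fun n (q : ℚ) => T n q)
    fun n q _ => abs_le.1 (hC q n)
  rw [tendsto_pi_nhds] at hg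
  let U : Ultrafilter ℕ := hyperfilter ℕ
  have hU : (U : Filter ℕ) ≤ atTop := Nat.hyperfilter_le_atTop
  have hG (x : ℝ) : ∃ y, Tendsto (fun n => T (φ n) x) U (𝓝 y) := by
    obtain ⟨y, -, hy⟩ := isCompact_Icc.ultrafilter_le_nhds (s := Icc (-C x) (C x))
      (U.map fun n => T (φ n) x)
      (tendsto_principal.2 (Eventually.of_forall fun n => abs_le.1 (hC x (φ n))))
    exact ⟨y, hy⟩
  choose G hG using hG
  have hmono : Monotone G := fun x y hxy => le_of_tendsto_of_tendsto' (hG x) (hG y) fun n => hT _ hxy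
  refine ⟨φ, hφ, G, hmono, fun x => ?_,
    hmono.countable_not_continuousAt.mono fun x hx (hc : ContinuousAt G x) => hx ?_⟩
  · refine tendsto_nhds_unique (hG _) ?_
    simp only [hper]
    exact (hG x).add_const _
  · have hq (q : ℚ) : Tendsto (fun n => T (φ n) q) atTop (𝓝 (G q)) := by
      rw [tendsto_nhds_unique (hG q) ((hg q).mono_left hU)]
      exact hg q
    refine tendsto_order.2 ⟨fun a ha => ?_, fun a ha => ?_⟩
    · obtain ⟨l, hl, hlx⟩ := exists_Ioc_subset_of_mem_nhds (hc.eventually_const_lt ha)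
        ⟨x - 1, by simp⟩
      obtain ⟨q, hlq, hqx⟩ := exists_rat_btwn hl
      filter_upwards [(hq q).eventually_const_lt (hlx ⟨hlq, hqx.le⟩)] with n hn
      exact hn.trans_le (hT _ hqx.le)
    · obtain ⟨l, hl, hlx⟩ := exists_Ico_subset_of_mem_nhds (hc.eventually_lt_const ha)
        ⟨x + 1, by simp⟩
      obtain ⟨q, hqx, hlq⟩ := exists_rat_btwn hl
      filter_upwards [(hq q).eventually_lt_const (hlx ⟨hqx.le, hlq⟩)] with n hn
      exact (hT _ hqx.le).trans_lt hn

lemma abs_apply_zero_le {T : ℝ → ℝ} (hT : Monotone T) (hper : ∀ x, T (x + 2 * π) = T x + 2 * π)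
    (hmean : ∫ u in (0:ℝ)..(2 * π), (T u - u) = 0) : |T 0| ≤ 2 * π := by
  have hpi : 0 < 2 * π := by positivity
  have i1 : IntervalIntegrable T volume 0 (2 * π) := hT.intervalIntegrable
  have i3 : IntervalIntegrable (fun u : ℝ => u) volume 0 (2 * π) := intervalIntegral.intervalIntegrable_id
  rw [intervalIntegral.integral_sub i1 i3, integral_id] at hmean
  have hp := hper 0
  rw [zero_add] at hp
  have h1 := intervalIntegral.integral_mono_on hpi.le intervalIntegrable_const i1
    fun u hu => hT hu.1
  have h2 := intervalIntegral.integral_mono_on hpi.le i1 intervalIntegrable_const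
    fun u hu => hT hu.2
  rw [intervalIntegral.integral_const, smul_eq_mul] at h1 h2
  rw [abs_le]
  constructor <;> nlinarith

lemma abs_apply_le {T : ℝ → ℝ} (hT : Monotone T) (hper : ∀ x, T (x + 2 * π) = T x + 2 * π)
    (hmean : ∫ u in (0:ℝ)..(2 * π), (T u - u) = 0) {x : ℝ} (hx : x ∈ Icc 0 (2 * π)) :
    |T x| ≤ 4 * π := by
  have h0 := abs_le.1 (abs_apply_zero_le hT hper hmean)
  have h1 := hT hx.1
  have h2 := hT hx.2
  have hp := hper 0
  rw [zero_add] at hp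
  rw [abs_le]
  constructor <;> linarith [Real.pi_pos]

lemma apply_add_int_mul {T : ℝ → ℝ} (hper : ∀ x, T (x + 2 * π) = T x + 2 * π) (x : ℝ) (k : ℤ) :
    T (x + k * (2 * π)) = T x + k * (2 * π) := by
  have h : Function.Periodic (fun y => T y - y) (2 * π) := fun y => by
    simp only [hper]; ring
  have := (h.int_mul k) x
  linarith

lemma exists_abs_apply_le (x : ℝ) : ∃ C, ∀ T : ℝ → ℝ, Monotone T →
    (∀ y, T (y + 2 * π) = T y + 2 * π) → (∫ u in (0:ℝ)..(2 * π), (T u - u)) = 0 → |T x| ≤ C := by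
  obtain ⟨y, hy, -⟩ := existsUnique_sub_zsmul_mem_Ico (show 0 < 2 * π by positivity) x 0
  refine ⟨4 * π + |y * (2 * π)|, fun T hT hper hmean => ?_⟩
  rw [zsmul_eq_mul, zero_add] at hy
  have h1 := abs_apply_le hT hper hmean (Ico_subset_Icc_self hy)
  have h2 := apply_add_int_mul hper (x - y * (2 * π)) y
  rw [sub_add_cancel] at h2
  rw [h2]
  exact (abs_add_le _ _).trans (by linarith)

lemma ae_logc_of_countable {σ : Measure S1} (hσ : σ ≪ volume) {p : ℝ → Prop}
    (hp : {x | ¬ p x}.Countable) : ∀ᵐ z ∂σ, p (logc z) :=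
  measure_countable_eq_zero hσ (hp.preimage logc_injective)

lemma continuous_expc : Continuous expc := AddCircle.continuous_mk' _

/-- Lifts of optimal transport maps are stable under convergence outside a countable set. -/
lemma IsOTMLift.of_tendsto {σ μ : Measure S1} [IsProbabilityMeasure σ] [IsProbabilityMeasure μ]
    (hσ : σ ≪ volume) {μs : ℕ → Measure S1} [∀ n, IsProbabilityMeasure (μs n)]
    (hW : Tendsto (fun n => W2sq (μs n) μ) atTop (𝓝 0)) {L : ℝ → ℝ} (hL : IsOTMLift σ μ L)
    {T : ℕ → ℝ → ℝ} (hT : ∀ n, IsOTMLift σ (μs n) (T n)) {G : ℝ → ℝ} (hG : Monotone G)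
    (hGper : ∀ x, G (x + 2 * π) = G x + 2 * π)
    (hlim : {x | ¬ Tendsto (fun n => T n x) atTop (𝓝 (G x))}.Countable) : IsOTMLift σ μ G := by
  have hpi : 0 < 2 * π := by positivity
  have hS : Measurable fun z => expc (G (logc z)) :=
    continuous_expc.measurable.comp (hG.measurable.comp measurable_logc)
  have hSlim : ∀ᵐ z ∂σ, Tendsto (fun n => expc (T n (logc z))) atTop (𝓝 (expc (G (logc z)))) :=
    (ae_logc_of_countable hσ hlim).mono fun z hz => (continuous_expc.tendsto _).comp hz
  have hmap : σ.map (fun z => expc (G (logc z))) = μ := by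
    have := Measure.isProbabilityMeasure_map hS.aemeasurable (μ := σ)
    refine ext_of_forall_integral_eq_of_IsFiniteMeasure fun f => ?_
    rw [integral_map hS.aemeasurable f.continuous.measurable.aestronglyMeasurable]
    have t1 : Tendsto (fun n => ∫ x, f x ∂(μs n)) atTop (𝓝 (∫ z, f (expc (G (logc z))) ∂σ)) := by
      have e (n : ℕ) : ∫ x, f x ∂(μs n) = ∫ z, f (expc (T n (logc z))) ∂σ := by
        have ho := (hT n).2.2.2
        conv_lhs => rw [← ho.2.1]
        exact integral_map ho.1.aemeasurable f.continuous.measurable.aestronglyMeasurable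
      simp only [e]
      refine tendsto_integral_of_dominated_convergence (fun _ => ‖f‖)
        (fun n => (f.continuous.measurable.comp (hT n).2.2.2.1).aestronglyMeasurable)
        (integrable_const _) (fun n => ae_of_all _ fun z => f.norm_coe_le_norm _) ?_
      exact hSlim.mono fun z hz => (f.continuous.tendsto _).comp hz
    have t2 : Tendsto (fun n => ∫ x, f x ∂(μs n)) atTop (𝓝 (∫ x, f x ∂μ)) := by
      rw [Metric.tendsto_atTop']
      intro ε hε
      obtain ⟨C, hC, h⟩ := abs_integral_sub_le f.continuous (half_pos hε)
      obtain ⟨N, hN⟩ := eventually_atTop.1 (hW.eventually_lt_const (show 0 < ε / 2 / C by positivity))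
      refine ⟨N, fun n hn => ?_⟩
      rw [Real.dist_eq]
      have h1 := h (μs n) μ
      have h2 := hN n hn.le
      rw [lt_div_iff₀ hC] at h2
      linarith
    exact tendsto_nhds_unique t1 t2
  refine ⟨hG, hGper, ?_, hS, hmap, le_antisymm ?_ ?_⟩
  · have t : Tendsto (fun n => ∫ u in (0:ℝ)..(2 * π), (T n u - u)) atTop
        (𝓝 (∫ u in (0:ℝ)..(2 * π), (G u - u))) := by
      refine intervalIntegral.tendsto_integral_filter_of_dominated_convergence (fun _ => 6 * π)
        (Eventually.of_forall fun n => ((hT n).1.measurable.sub measurable_id).aestronglyMeasurable)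
        (Eventually.of_forall fun n => ae_of_all _ fun u hu => ?_) intervalIntegrable_const
        ((measure_eq_zero_iff_ae_notMem.1 (hlim.measure_zero volume)).mono fun u hu _ =>
          (not_not.1 hu).sub_const u)
      rw [uIoc_of_le hpi.le] at hu
      have h1 := abs_apply_le (hT n).1 (hT n).2.1 (hT n).2.2.1 (Ioc_subset_Icc_self hu)
      have h2 := abs_sub (T n u) u
      rw [Real.norm_eq_abs]
      rw [abs_of_pos hu.1] at h2
      linarith [hu.2]
    simp only [(hT _).2.2.1] at t
    exact tendsto_nhds_unique t tendsto_const_nhds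
  · have t : Tendsto (fun n => W2sq σ (μs n)) atTop
        (𝓝 (∫ z, dist z (expc (G (logc z))) ^ 2 ∂σ)) := by
      simp only [← (hT _).2.2.2.2.2]
      refine tendsto_integral_of_dominated_convergence (fun _ => π ^ 2)
        (fun n => ((measurable_id.dist (hT n).2.2.2.1).pow_const 2).aestronglyMeasurable)
        (integrable_const _) (fun n => ae_of_all _ fun z => ?_)
        (hSlim.mono fun z hz => (tendsto_const_nhds.dist hz).pow 2)
      rw [Real.norm_eq_abs, abs_of_nonneg (by positivity)]
      gcongr
      exact dist_le_pi _ _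
    rw [← hL.2.2.2.2.2]
    refine le_of_forall_pos_le_add fun ε hε => ?_
    obtain ⟨C, hC, h⟩ := W2sq_le_add hε
    have t' := (hW.const_mul C).const_add ((∫ z, dist z (expc (L (logc z))) ^ 2 ∂σ) + ε)
    rw [mul_zero, add_zero] at t'
    exact le_of_tendsto_of_tendsto' t t' fun n => h σ μ (μs n) _ hL.2.2.2.1 hL.2.2.2.2.1
  · rw [← integral_sqDist_map_graph σ hS]
    exact W2sq_le (IsCoupling.of_map hS hmap)

lemma tendsto_integral_sub_sq {σ μ : Measure S1} [IsProbabilityMeasure σ] [IsProbabilityMeasure μ]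
    (hσ : σ ≪ volume) (hμ : μ ≪ volume) {μs : ℕ → Measure S1} [∀ n, IsProbabilityMeasure (μs n)]
    (hW : Tendsto (fun n => W2sq (μs n) μ) atTop (𝓝 0)) {L : ℝ → ℝ} (hL : IsOTMLift σ μ L)
    {T : ℕ → ℝ → ℝ} (hT : ∀ n, IsOTMLift σ (μs n) (T n)) :
    ∃ φ : ℕ → ℕ, Tendsto (fun n => ∫ x, (T (φ n) x - L x) ^ 2 ∂(tilde σ)) atTop (𝓝 0) := by
  have hb (x : ℝ) : ∃ C, ∀ n, |T n x| ≤ C := by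
    obtain ⟨C, hC⟩ := exists_abs_apply_le x
    exact ⟨C, fun n => hC _ (hT n).1 (hT n).2.1 (hT n).2.2.1⟩
  obtain ⟨φ, hφ, G, hG, hGper, hlim⟩ :=
    exists_subseq_tendsto_of_monotone (fun n => (hT n).1) hb fun n => (hT n).2.1
  have hGL := (hL.ae_eq hσ hμ (IsOTMLift.of_tendsto hσ (hW.comp hφ.tendsto_atTop) hL
    (fun n => hT (φ n)) hG hGper hlim))
  refine ⟨φ, ?_⟩
  have hm (n : ℕ) : Measurable fun x => (T (φ n) x - L x) ^ 2 :=
    ((hT _).1.measurable.sub hL.1.measurable).pow_const 2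
  have e (n : ℕ) : ∫ x, (T (φ n) x - L x) ^ 2 ∂(tilde σ)
      = ∫ z, (T (φ n) (logc z) - L (logc z)) ^ 2 ∂σ :=
    integral_map measurable_logc.aemeasurable (hm n).aestronglyMeasurable
  simp only [e]
  rw [← integral_zero S1 ℝ (μ := σ)]
  refine tendsto_integral_of_dominated_convergence (fun _ => (8 * π) ^ 2)
    (fun n => ((hm n).comp measurable_logc).aestronglyMeasurable) (integrable_const _)
    (fun n => ae_of_all _ fun z => ?_) ?_
  · have hz := Ico_subset_Icc_self (logc_mem z)
    have h1 := abs_apply_le (hT (φ n)).1 (hT (φ n)).2.1 (hT (φ n)).2.2.1 hz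
    have h2 := abs_apply_le hL.1 hL.2.1 hL.2.2.1 hz
    rw [Real.norm_eq_abs, abs_pow]
    gcongr
    exact (abs_sub _ _).trans (by linarith)
  · filter_upwards [hGL, ae_logc_of_countable hσ hlim] with z h1 h2
    rw [← h1] at h2
    simpa using (h2.sub_const (L (logc z))).pow 2

/-- If `W₂(μ_t, μ₀) → 0` as `t → 0⁺`, with `σ` and the `μ_t` having
geodesically convex supports and densities bounded above and below away from zero, then the
lifts of the optimal transport maps from `σ` converge in `L²(σ̃)`. -/
theorem stmt7 (σ : Measure S1) [IsProbabilityMeasure σ] (hacσ : σ ≪ volume)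
    (μt : ℝ → Measure S1) (μ0 : Measure S1)
    [∀ t, IsProbabilityMeasure (μt t)] [IsProbabilityMeasure μ0]
    (hacμt : ∀ t : ℝ, 0 < t → μt t ≪ volume) (hacμ0 : μ0 ≪ volume)
    (hσ : NiceDensity σ) (hμt : ∀ t : ℝ, 0 < t → NiceDensity (μt t)) (hμ0 : NiceDensity μ0)
    (hconv : Tendsto (fun t => Real.sqrt (W2sq (μt t) μ0)) (𝓝[>] 0) (𝓝 0))
    (Lt : ℝ → ℝ → ℝ) (hLt : ∀ t : ℝ, 0 < t → IsOTMLift σ (μt t) (Lt t))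
    (L0 : ℝ → ℝ) (hL0 : IsOTMLift σ μ0 L0) :
    Tendsto (fun t => ∫ x, (Lt t x - L0 x) ^ 2 ∂(tilde σ)) (𝓝[>] 0) (𝓝 0) := by
  refine tendsto_of_subseq_tendsto fun ns hns => ?_
  obtain ⟨N, hN⟩ := eventually_atTop.1 (hns.eventually self_mem_nhdsWithin)
  have hshift : Tendsto (fun n => ns (n + N)) atTop (𝓝[>] 0) :=
    hns.comp (tendsto_add_atTop_nat N)
  have hpos (n : ℕ) : 0 < ns (n + N) := hN _ (Nat.le_add_left N n)
  have hW : Tendsto (fun t => W2sq (μt t) μ0) (𝓝[>] 0) (𝓝 0) := by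
    simpa [Real.sq_sqrt (W2sq_nonneg _ _)] using hconv.pow 2
  obtain ⟨φ, hφ⟩ := tendsto_integral_sub_sq hacσ hacμ0 (hW.comp hshift) hL0
    (T := fun n => Lt (ns (n + N))) fun n => hLt _ (hpos n)
  exact ⟨fun n => φ n + N, hφ⟩

end
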